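/- Let R be a commutative Noetherian ring, M a finitely generated R-module, N a proper submodule of M, and a = Ann_R(M/N) = (N : M). If every prime ideal in Ass_R(M/N) is isolated (i.e., every associated prime of M/N is a minimal element of Ass_R(M/N)), then P_R(a) = P_M(N); that is, the generalized prime ideal factorization of the ideal a in R coincides (as a multiset of prime ideals counted with multiplicity) with the generalized prime ideal factorization of N in M. -/

import Mathlib

open Submodule

section Defs

variable {R : Type*} [CommRing R] {M : Type*} [AddCommGroup M] [Module R M]

/-- `K` is a `p`-prime extension of `N` (i.e. `N` is a `p`-prime submodule of `K`):
`(N : K) = p` and for all `a : R`, `x ∈ K`, `a • x ∈ N` implies `a ∈ p` or `x ∈ N`. -/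
def IsPrimeExtension (p : Ideal R) (N K : Submodule R M) : Prop :=
  p.IsPrime ∧ N ≤ K ∧ N.colon K = p ∧
    ∀ (a : R) (x : M), x ∈ K → a • x ∈ N → a ∈ p ∨ x ∈ N

/-- `K` is a maximal `p`-prime extension of `N` in the ambient module: no `p`-prime
extension of `N` properly contains `K`. -/
def IsMaximalPrimeExtension (p : Ideal R) (N K : Submodule R M) : Prop :=
  IsPrimeExtension p N K ∧ ∀ L : Submodule R M, IsPrimeExtension p N L → ¬ K < L

/-- `K` is a regular `p`-prime extension of `N` in the ambient module: `K` is a maximal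
`p`-prime extension of `N` and `p` is a maximal element of `Ass(M/N)`. -/
def IsRegularPrimeExtension (p : Ideal R) (N K : Submodule R M) : Prop :=
  IsMaximalPrimeExtension p N K ∧ p ∈ associatedPrimes R (M ⧸ N) ∧
    ∀ q ∈ associatedPrimes R (M ⧸ N), p ≤ q → q = p

/-- `F 0 = N ⊂ F 1 ⊂ ⋯ ⊂ F n = M` is a regular prime extension (RPE) filtration
of the ambient module over `N`, with prime ideals `p 0, …, p (n-1)`. -/
def IsRPEFiltration (N : Submodule R M) (n : ℕ) (F : Fin (n + 1) → Submodule R M)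
    (p : Fin n → Ideal R) : Prop :=
  F 0 = N ∧ F (Fin.last n) = ⊤ ∧
    ∀ i : Fin n, IsRegularPrimeExtension (p i) (F i.castSucc) (F i.succ)

/-- `N` has generalized prime ideal factorization given by the multiset `S` of primes. -/
def HasPFactorization (N : Submodule R M) (S : Multiset (Ideal R)) : Prop :=
  ∃ (n : ℕ) (F : Fin (n + 1) → Submodule R M) (p : Fin n → Ideal R),
    IsRPEFiltration N n F p ∧ (List.ofFn p : Multiset (Ideal R)) = S

end Defs

section PrimeExtensions

variable {R : Type*} [CommRing R] {M : Type*} [AddCommGroup M] [Module R M]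

/-- Induction along a regular prime extension filtration, from the top downwards. -/
theorem HasPFactorization.induction {motive : Submodule R M → Multiset (Ideal R) → Prop}
    (top : motive ⊤ 0)
    (step : ∀ N K p S, IsRegularPrimeExtension p N K → motive K S → motive N (p ::ₘ S))
    {N : Submodule R M} {S : Multiset (Ideal R)} (h : HasPFactorization N S) : motive N S := by
  obtain ⟨n, F, p, ⟨h0, hlast, hreg⟩, rfl⟩ := h
  induction n generalizing N with
  | zero =>
    obtain rfl : N = ⊤ := by rw [← h0, ← hlast]; rfl
    simpa using top
  | succ n ih =>
    rw [List.ofFn_succ, ← Multiset.cons_coe]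
    refine step N (F 1) (p 0) _ ?_ ?_
    · simpa [h0] using hreg 0
    · exact ih (fun i => F i.succ) (fun i => p i.succ) rfl hlast fun i => hreg i.succ

theorem mem_associatedPrimes_quotient_iff [IsNoetherianRing R] {N : Submodule R M} {p : Ideal R} :
    p ∈ associatedPrimes R (M ⧸ N) ↔ p.IsPrime ∧ ∃ x : M, p = N.colon {x} := by
  have key (x : M) : (⊥ : Submodule R (M ⧸ N)).colon {N.mkQ x} = N.colon {x} := by
    ext r
    rw [mem_colon_singleton, mem_colon_singleton, mem_bot, ← map_smul, mkQ_apply,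
      Quotient.mk_eq_zero]
  rw [AssociatedPrimes.mem_iff, isAssociatedPrime_iff, N.mkQ_surjective.exists]
  simp only [key]

/-- If the colon of `N` by a finitely generated submodule is prime, it is an associated prime. -/
theorem colon_mem_associatedPrimes_of_fg [IsNoetherianRing R] {N G : Submodule R M} (hG : G.FG)
    (hp : (N.colon (G : Set M)).IsPrime) : N.colon (G : Set M) ∈ associatedPrimes R (M ⧸ N) := by
  obtain ⟨s, rfl⟩ := hG
  have hle : s.inf (fun x => N.colon {x}) ≤ N.colon (span R (s : Set M) : Set M) := by
    rw [colon_span]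
    intro r hr
    rw [mem_colon]
    intro x hx
    rw [Submodule.mem_finsetInf] at hr
    exact mem_colon_singleton.mp (hr x hx)
  obtain ⟨x, hx, hxle⟩ := hp.inf_le'.mp hle
  refine mem_associatedPrimes_quotient_iff.mpr ⟨hp, x, le_antisymm ?_ hxle⟩
  exact colon_mono le_rfl (Set.singleton_subset_iff.mpr (subset_span hx))

theorem associatedPrimes_quotient_colon_subset [IsNoetherianRing R] [Module.Finite R M]
    (N : Submodule R M) :
    associatedPrimes R (R ⧸ N.colon (Set.univ : Set M)) ⊆ associatedPrimes R (M ⧸ N) := by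
  intro p hp
  obtain ⟨hprime, r, rfl⟩ := mem_associatedPrimes_quotient_iff.mp hp
  have heq : (N.colon (Set.univ : Set M)).colon {r} =
      N.colon ((⊤ : Submodule R M).map (LinearMap.lsmul R M r) : Set M) := by
    ext t
    simp [mem_colon, mul_smul]
  rw [heq] at hprime ⊢
  exact colon_mem_associatedPrimes_of_fg (Module.Finite.fg_top.map _) hprime

theorem IsPrimeExtension.mul_colon_le {p : Ideal R} {N K : Submodule R M}
    (h : IsPrimeExtension p N K) (S : Set M) : p * K.colon S ≤ N.colon S := by
  rw [Ideal.mul_le]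
  intro a ha b hb
  rw [← h.2.2.1] at ha
  rw [mem_colon] at ha hb ⊢
  intro x hx
  rw [mul_smul]
  exact ha _ (hb x hx)

/-- A regular `p`-prime extension of `N` consists of all elements sent into `N` by `p`. -/
theorem IsRegularPrimeExtension.mem_iff [IsNoetherianRing R] {p : Ideal R} {N K : Submodule R M}
    (h : IsRegularPrimeExtension p N K) {x : M} : x ∈ K ↔ ∀ a ∈ p, a • x ∈ N := by
  obtain ⟨⟨⟨hprime, hNK, hcolon, -⟩, hmax⟩, -, hass⟩ := h
  let L : Submodule R M :=
    { carrier := {x | ∀ a ∈ p, a • x ∈ N}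
      add_mem' := fun hx hy a ha => by rw [smul_add]; exact N.add_mem (hx a ha) (hy a ha)
      zero_mem' := fun a _ => by simp
      smul_mem' := fun c x hx a ha => by rw [smul_comm]; exact N.smul_mem c (hx a ha) }
  have hKL : K ≤ L := by
    intro x hx a ha
    rw [← hcolon] at ha
    exact mem_colon.mp ha x hx
  have hL : IsPrimeExtension p N L := by
    refine ⟨hprime, hNK.trans hKL, le_antisymm ?_ ?_, ?_⟩
    · exact (colon_mono le_rfl hKL).trans hcolon.le
    · exact fun a ha => mem_colon.mpr fun x hx => hx a ha
    · intro a x hx hax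
      by_cases hxN : x ∈ N
      · exact Or.inr hxN
      obtain ⟨P, hP, hle⟩ := exists_le_isAssociatedPrime_of_isNoetherianRing R (N.mkQ x)
        (by simpa using hxN)
      have hcol {b : R} (hb : b • x ∈ N) : b ∈ P := by
        refine hle (mem_colon_singleton.mpr ?_)
        rw [mem_bot, ← map_smul, mkQ_apply, Quotient.mk_eq_zero]
        exact hb
      have hPp : P = p := hass P hP fun b hb => hcol (hx b hb)
      exact Or.inl (hPp ▸ hcol hax)
  have hEq : K = L := hKL.eq_of_not_lt (hmax L hL)
  rw [hEq]
  rfl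

theorem IsRegularPrimeExtension.associatedPrimes_subset [IsNoetherianRing R] {p : Ideal R}
    {N K : Submodule R M} (h : IsRegularPrimeExtension p N K) :
    associatedPrimes R (M ⧸ K) ⊆ associatedPrimes R (M ⧸ N) := by
  intro P hP
  obtain ⟨hprime, x, rfl⟩ := mem_associatedPrimes_quotient_iff.mp hP
  have heq : K.colon {x} = N.colon (Submodule.map (LinearMap.toSpanSingleton R M x) p : Set M) := by
    ext t
    rw [mem_colon_singleton, h.mem_iff]
    simp only [mem_colon, map_coe, Set.forall_mem_image,
      SetLike.mem_coe, LinearMap.toSpanSingleton_apply]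
    simp only [smul_comm t]
  rw [heq] at hprime ⊢
  exact colon_mem_associatedPrimes_of_fg ((IsNoetherian.noetherian p).map _) hprime

theorem HasPFactorization.mem_associatedPrimes [IsNoetherianRing R] {N : Submodule R M}
    {S : Multiset (Ideal R)} (h : HasPFactorization N S) :
    ∀ p ∈ S, p ∈ associatedPrimes R (M ⧸ N) := by
  refine h.induction (motive := fun N S => ∀ p ∈ S, p ∈ associatedPrimes R (M ⧸ N)) (by simp)
    fun N K p S hreg ih q hq => ?_
  rcases Multiset.mem_cons.mp hq with rfl | hq
  · exact hreg.2.1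
  · exact hreg.associatedPrimes_subset (ih q hq)

open Classical in
/-- If no other factor is contained in `q`, the power of `q` in the factorization of `N`
annihilates `M ⧸ N` locally at `q`. -/
theorem HasPFactorization.exists_mul_pow_count_le {N : Submodule R M} {S : Multiset (Ideal R)}
    (h : HasPFactorization N S) {q : Ideal R} (hq : q.IsPrime) (hS : ∀ p ∈ S, p ≤ q → p = q) :
    ∃ s ∉ q, Ideal.span {s} * q ^ S.count q ≤ N.colon (Set.univ : Set M) := by
  revert hS
  refine h.induction (motive := fun N S => (∀ p ∈ S, p ≤ q → p = q) →
      ∃ s ∉ q, Ideal.span {s} * q ^ S.count q ≤ N.colon (Set.univ : Set M))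
    (fun _ => ⟨1, hq.one_notMem, by simp⟩) fun N K p S hreg ih hS => ?_
  obtain ⟨s, hs, hle⟩ := ih fun p' hp' => hS p' (Multiset.mem_cons_of_mem hp')
  have hmul := hreg.1.1.mul_colon_le (Set.univ : Set M)
  by_cases hpq : p = q
  · subst hpq
    refine ⟨s, hs, ?_⟩
    rw [Multiset.count_cons_self, pow_succ', mul_left_comm]
    exact (Ideal.mul_mono_right hle).trans hmul
  · obtain ⟨t, htp, htq⟩ : ∃ t ∈ p, t ∉ q :=
      SetLike.not_le_iff_exists.mp fun hle => hpq (hS p (Multiset.mem_cons_self p S) hle)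
    refine ⟨t * s, fun hts => (hq.mem_or_mem hts).elim htq hs, ?_⟩
    rw [Multiset.count_cons_of_ne (Ne.symm hpq), ← Ideal.span_singleton_mul_span_singleton,
      mul_assoc]
    refine (Ideal.mul_mono ?_ hle).trans hmul
    rwa [Ideal.span_singleton_le_iff_mem]

open Classical in
/-- If `q ^ j` annihilates `M ⧸ N` locally at `q`, then `q` occurs at most `j` times in the
factorization of `N`. -/
theorem HasPFactorization.count_le [IsNoetherianRing R] {N : Submodule R M}
    {S : Multiset (Ideal R)} (h : HasPFactorization N S) {q : Ideal R} {s : R} (hs : s ∉ q) {j : ℕ}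
    (hj : Ideal.span {s} * q ^ j ≤ N.colon (Set.univ : Set M)) : S.count q ≤ j := by
  revert j
  refine h.induction (motive := fun N S => ∀ {j : ℕ},
      Ideal.span {s} * q ^ j ≤ N.colon (Set.univ : Set M) → S.count q ≤ j)
    (by simp) fun N K p S hreg ih j hj => ?_
  by_cases hpq : p = q
  · subst hpq
    rw [Multiset.count_cons_self]
    cases j with
    | zero =>
      obtain ⟨-, x, hx⟩ := mem_associatedPrimes_quotient_iff.mp hreg.2.1
      rw [pow_zero, mul_one, Ideal.span_singleton_le_iff_mem] at hj
      exact absurd (hx ▸ colon_mono le_rfl (Set.subset_univ _) hj) hs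
    | succ j =>
      refine Nat.succ_le_succ (ih fun b hb => mem_colon.mpr fun x hx => ?_)
      rw [hreg.mem_iff]
      intro a ha
      rw [smul_smul]
      refine mem_colon.mp (hj ?_) x hx
      rw [pow_succ', mul_left_comm]
      exact Ideal.mul_mem_mul ha hb
  · rw [Multiset.count_cons_of_ne (Ne.symm hpq)]
    exact ih (hj.trans (colon_mono hreg.1.1.2.1 le_rfl))

end PrimeExtensions

/-- For a proper submodule `N` of `M` with `a = Ann_R(M/N) = (N : M)`: if every prime in
`Ass_R(M/N)` is isolated (minimal in `Ass_R(M/N)`), then `P_R(a) = P_M(N)` as multisets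
of primes counted with multiplicity. -/
theorem stmt_16 {R : Type*} [CommRing R] [IsNoetherianRing R]
    {M : Type*} [AddCommGroup M] [Module R M] [Module.Finite R M]
    (N : Submodule R M) (hN : N ≠ ⊤) (a : Ideal R) (ha : a = N.colon ⊤)
    (hiso : ∀ q ∈ associatedPrimes R (M ⧸ N),
      ∀ q' ∈ associatedPrimes R (M ⧸ N), q' ≤ q → q' = q)
    (S T : Multiset (Ideal R))
    (hfN : HasPFactorization N S) (hfa : HasPFactorization (M := R) a T) :
    T = S := by
  classical
  subst ha
  have hcolon : (N.colon (Set.univ : Set M)).colon (Set.univ : Set R) =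
      N.colon (Set.univ : Set M) := colon_univ
  have hSass := hfN.mem_associatedPrimes
  have hTass : ∀ p ∈ T, p ∈ associatedPrimes R (M ⧸ N) := fun p hp =>
    associatedPrimes_quotient_colon_subset N (hfa.mem_associatedPrimes p hp)
  ext q
  by_cases hq : q ∈ associatedPrimes R (M ⧸ N)
  · have hprime : q.IsPrime := hq.1
    apply le_antisymm
    · obtain ⟨s, hs, hle⟩ := hfN.exists_mul_pow_count_le hprime
        fun p hp => hiso q hq p (hSass p hp)
      exact hfa.count_le hs (hle.trans hcolon.ge)
    · obtain ⟨s, hs, hle⟩ := hfa.exists_mul_pow_count_le hprime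
        fun p hp => hiso q hq p (hTass p hp)
      exact hfN.count_le hs (hle.trans hcolon.le)
  · rw [Multiset.count_eq_zero_of_notMem fun h => hq (hTass q h),
      Multiset.count_eq_zero_of_notMem fun h => hq (hSass q h)]
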